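/- Fix a real constant c > 0 and an integer K ≥ 2. Let p(N, M) denote the probability that a random K-SAT instance with N variables and M clauses is satisfiable. Then there exist α ∈ (0,1) and a constant C > 0 such that for all N_1, N_2 ≥ 1 with N = N_1 + N_2, log p(N, ⌊cN⌋) ≥ log p(N_1, ⌊cN_1⌋) + log p(N_2, ⌊cN_2⌋) − C N^α. -/

import Mathlib

open Filter
open scoped Classical

/-- A clause of a `K`-SAT instance on variables `Fin N`: `K` variable indices together
with the forbidden tuple `a ∈ {0,1}^K`. -/
abbrev Clause (N K : ℕ) := (Fin K → Fin N) × (Fin K → Bool)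

/-- Probability of an event `p` for a random `K`-SAT instance with `N` variables and `M`
clauses: the `M` clauses (variable indices and forbidden tuples) are drawn independently
and uniformly at random. -/
noncomputable def probKSAT (N K M : ℕ) (p : (Fin M → Clause N K) → Prop) : ℝ :=
  (((Finset.univ : Finset (Fin M → Clause N K)).filter p).card : ℝ) /
    (Fintype.card (Fin M → Clause N K) : ℝ)

/-- `pSat N K M` is the probability that a random `K`-SAT instance with `N` variables and
`M` clauses is satisfiable. -/
noncomputable def pSat (N K M : ℕ) : ℝ :=
  probKSAT N K M (fun C => ∃ x : Fin N → Bool,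
    ∀ m : Fin M, (fun k => x ((C m).1 k)) ≠ (C m).2)

section AvgOp

variable {ι κ X : Type*} [Fintype ι] [Fintype κ]

/-- The operator that averages `F (S ∩ φ i)` over a uniformly random constraint `φ i`. -/
noncomputable def avgOp (φ : ι → Set X) : Module.End ℝ (Set X → ℝ) where
  toFun F S := (∑ i, F (S ∩ φ i)) / Fintype.card ι
  map_add' F G := by
    funext S
    simp [Finset.sum_add_distrib, add_div]
  map_smul' r F := by
    funext S
    simp [← Finset.mul_sum, mul_div_assoc]

/-- The indicator of the event that a set of assignments is nonempty. -/
noncomputable def nonemptyInd (S : Set X) : ℝ := if S.Nonempty then 1 else 0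

theorem avgOp_apply (φ : ι → Set X) (F : Set X → ℝ) (S : Set X) :
    avgOp φ F S = (∑ i, F (S ∩ φ i)) / Fintype.card ι := rfl

theorem avgOp_commute (φ : ι → Set X) (ψ : κ → Set X) : Commute (avgOp φ) (avgOp ψ) := by
  refine LinearMap.ext fun F => funext fun S => ?_
  simp only [Module.End.mul_apply, avgOp_apply, ← Finset.sum_div]
  rw [Finset.sum_comm, div_right_comm]
  simp only [Set.inter_right_comm]

theorem avgOp_mono (φ : ι → Set X) : Monotone (avgOp φ) := fun F G h S => by
  simp only [avgOp_apply]
  gcongr with i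
  exact h _

theorem avgOp_pow_mono (φ : ι → Set X) (M : ℕ) : Monotone ⇑(avgOp φ ^ M) := by
  rw [Module.End.coe_pow]
  exact (avgOp_mono φ).iterate M

theorem avgOp_pow_apply (φ : ι → Set X) (M : ℕ) (F : Set X → ℝ) (S : Set X) :
    (avgOp φ ^ M) F S =
      (∑ C : Fin M → ι, F (S ∩ ⋂ m, φ (C m))) / (Fintype.card ι : ℝ) ^ M := by
  induction M generalizing S with
  | zero => simp
  | succ M ih =>
    rw [pow_succ', Module.End.mul_apply, avgOp_apply]
    simp only [ih, ← Finset.sum_div]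
    rw [div_div, ← pow_succ, ← (Fin.consEquiv fun _ => ι).sum_comp, Fintype.sum_prod_type]
    congr 1
    refine Finset.sum_congr rfl fun i _ => Finset.sum_congr rfl fun C _ => ?_
    congr 1
    ext x
    simp [Fin.forall_fin_succ, and_assoc]

theorem nonemptyInd_nonneg : 0 ≤ (nonemptyInd : Set X → ℝ) := fun S => by
  unfold nonemptyInd
  split_ifs <;> simp

theorem avgOp_pow_nonemptyInd_nonneg (φ : ι → Set X) (ψ : κ → Set X) (a b : ℕ) (S : Set X) :
    0 ≤ (avgOp φ ^ a * avgOp ψ ^ b) nonemptyInd S := by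
  have h := avgOp_pow_mono ψ b nonemptyInd_nonneg
  rw [map_zero] at h
  have h' := avgOp_pow_mono φ a h
  rw [map_zero] at h'
  exact h' S

end AvgOp

section Clauses

variable {V W : Type*} {K : ℕ}

/-- The assignments on `V` satisfying a clause whose variables are read through `e : W → V`. -/
def clauseSat (e : W → V) (C : (Fin K → W) × (Fin K → Bool)) : Set (V → Bool) :=
  {x | (fun k => x (e (C.1 k))) ≠ C.2}

/-- The operator `avgOp` for a uniformly random clause read through `e : W → V`. -/
noncomputable abbrev clauseOp [Fintype W] (K : ℕ) (e : W → V) :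
    Module.End ℝ (Set (V → Bool) → ℝ) :=
  avgOp (clauseSat (K := K) e)

/-- The variables taking the same value in all assignments of `S`. -/
def frozen (S : Set (V → Bool)) (v : V) : Prop := ∀ x ∈ S, ∀ y ∈ S, x v = y v

theorem card_clause_kills [Fintype W] (e : W → V) {S : Set (V → Bool)} (hS : S.Nonempty) :
    (Finset.univ.filter fun C : (Fin K → W) × (Fin K → Bool) =>
      ¬ (S ∩ clauseSat e C).Nonempty).card =
      (Finset.univ.filter fun w : W => frozen S (e w)).card ^ K := by
  obtain ⟨x₀, hx₀⟩ := hS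
  have h : (Finset.univ.filter fun C : (Fin K → W) × (Fin K → Bool) =>
      ¬ (S ∩ clauseSat e C).Nonempty) =
      (Fintype.piFinset fun _ : Fin K => Finset.univ.filter fun w : W => frozen S (e w)).image
        (fun i => (i, fun k => x₀ (e (i k)))) := by
    ext ⟨i, a⟩
    simp only [Finset.mem_filter, Finset.mem_univ, true_and, Finset.mem_image,
      Fintype.mem_piFinset, Prod.mk.injEq]
    constructor
    · intro h
      have h' : ∀ x ∈ S, (fun k => x (e (i k))) = a := fun x hx => by
        by_contra hne
        exact h ⟨x, hx, hne⟩
      refine ⟨i, fun k x hx y hy => ?_, rfl, h' x₀ hx₀⟩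
      exact (congrFun (h' x hx) k).trans (congrFun (h' y hy) k).symm
    · rintro ⟨i, hi, rfl, rfl⟩ ⟨x, hx, hne⟩
      exact hne (funext fun k => hi k x hx x₀ hx₀)
  rw [h, Finset.card_image_of_injective _ (fun i j hij => (Prod.mk.inj hij).1),
    Fintype.card_piFinset]
  simp

theorem clauseOp_nonemptyInd [Fintype W] [Nonempty W] (e : W → V) {S : Set (V → Bool)}
    (hS : S.Nonempty) :
    clauseOp K e nonemptyInd S =
      1 - (2⁻¹ : ℝ) ^ K *
        (((Finset.univ.filter fun w : W => frozen S (e w)).card : ℝ) / Fintype.card W) ^ K := by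
  have h1 : ∀ C : (Fin K → W) × (Fin K → Bool), nonemptyInd (S ∩ clauseSat e C) =
      1 - if ¬ (S ∩ clauseSat e C).Nonempty then (1 : ℝ) else 0 := fun C => by
    unfold nonemptyInd
    split_ifs <;> simp
  have hW : (Fintype.card W : ℝ) ≠ 0 := Nat.cast_ne_zero.2 Fintype.card_ne_zero
  rw [avgOp_apply]
  simp only [h1, Finset.sum_sub_distrib, Finset.sum_boole, card_clause_kills e hS]
  simp only [Finset.sum_const, Finset.card_univ, Fintype.card_prod, Fintype.card_fun,
    Fintype.card_fin, Fintype.card_bool, nsmul_eq_mul, mul_one, Nat.cast_mul, Nat.cast_pow,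
    Nat.cast_ofNat]
  rw [div_pow, inv_pow]
  field_simp

theorem avgOp_nonemptyInd_empty {ι X : Type*} [Fintype ι] (φ : ι → Set X) :
    avgOp φ nonemptyInd ∅ = 0 := by
  simp [avgOp_apply, nonemptyInd]

theorem card_filter_div_le_one [Fintype W] (p : W → Prop) :
    ((Finset.univ.filter p).card : ℝ) / Fintype.card W ≤ 1 :=
  div_le_one_of_le₀ (Nat.cast_le.2 (Finset.card_le_univ _)) (Nat.cast_nonneg _)

theorem clauseOp_nonemptyInd_le [Fintype W] [Nonempty W] (e : W → V) :
    clauseOp K e nonemptyInd ≤ nonemptyInd := fun S => by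
  rcases S.eq_empty_or_nonempty with rfl | hS
  · simp [avgOp_nonemptyInd_empty, nonemptyInd]
  · rw [clauseOp_nonemptyInd e hS, nonemptyInd, if_pos hS, sub_le_self_iff]
    positivity

theorem le_clauseOp_nonemptyInd [Fintype W] [Nonempty W] (e : W → V) :
    (1 - (2⁻¹ : ℝ) ^ K) • nonemptyInd ≤ clauseOp K e nonemptyInd := fun S => by
  rcases S.eq_empty_or_nonempty with rfl | hS
  · simp [avgOp_nonemptyInd_empty, nonemptyInd]
  · rw [clauseOp_nonemptyInd e hS, Pi.smul_apply, nonemptyInd, if_pos hS, smul_eq_mul, mul_one]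
    refine sub_le_sub_left (mul_le_of_le_one_right (by positivity) ?_) _
    exact pow_le_one₀ (by positivity) (card_filter_div_le_one _)

end Clauses

theorem pSat_eq (N K M : ℕ) :
    pSat N K M = (clauseOp K (id : Fin N → _) ^ M) nonemptyInd Set.univ := by
  rw [avgOp_pow_apply, pSat, probKSAT, Fintype.card_fun, Fintype.card_fin, Nat.cast_pow]
  congr 1
  simp only [nonemptyInd, Set.univ_inter]
  rw [Finset.sum_boole]
  congr 2
  ext C
  simp [Set.Nonempty, clauseSat]

theorem pSat_succ_le {N : ℕ} (hN : 1 ≤ N) (K M : ℕ) : pSat N K (M + 1) ≤ pSat N K M := by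
  have : Nonempty (Fin N) := ⟨⟨0, hN⟩⟩
  rw [pSat_eq, pSat_eq, pow_succ, Module.End.mul_apply]
  exact avgOp_pow_mono _ M (clauseOp_nonemptyInd_le _) _

theorem le_pSat_succ {N : ℕ} (hN : 1 ≤ N) (K M : ℕ) :
    (1 - (2⁻¹ : ℝ) ^ K) * pSat N K M ≤ pSat N K (M + 1) := by
  have : Nonempty (Fin N) := ⟨⟨0, hN⟩⟩
  have h := avgOp_pow_mono (clauseSat (K := K) (id : Fin N → Fin N)) M
    (le_clauseOp_nonemptyInd (K := K) (id : Fin N → Fin N)) Set.univ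
  rw [map_smul] at h
  rw [pSat_eq, pSat_eq, pow_succ, Module.End.mul_apply]
  exact h

theorem one_sub_two_inv_pow_pos {K : ℕ} (hK : 2 ≤ K) : 0 < 1 - (2⁻¹ : ℝ) ^ K :=
  sub_pos.2 (pow_lt_one₀ (by norm_num) (by norm_num) (by omega))

theorem pSat_pos {N K : ℕ} (hN : 1 ≤ N) (hK : 2 ≤ K) (M : ℕ) : 0 < pSat N K M := by
  induction M with
  | zero => rw [pSat_eq]; simp [nonemptyInd]
  | succ M ih => exact (mul_pos (one_sub_two_inv_pow_pos hK) ih).trans_le (le_pSat_succ hN K M)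

theorem le_pSat_of_le_succ {N K M M' : ℕ} (hN : 1 ≤ N) (h : M' ≤ M + 1) :
    (1 - (2⁻¹ : ℝ) ^ K) * pSat N K M ≤ pSat N K M' :=
  (le_pSat_succ hN K M).trans (antitone_nat_of_succ_le (pSat_succ_le hN K) h)

section Split

variable {N₁ N₂ K : ℕ}

/-- The assignments whose restrictions to the two blocks of variables lie in `S` and `T`. -/
def blockProd (S : Set (Fin N₁ → Bool)) (T : Set (Fin N₂ → Bool)) :
    Set (Fin (N₁ + N₂) → Bool) :=
  {x | x ∘ Fin.castAdd N₂ ∈ S ∧ x ∘ Fin.natAdd N₁ ∈ T}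

theorem nonemptyInd_blockProd (S : Set (Fin N₁ → Bool)) (T : Set (Fin N₂ → Bool)) :
    nonemptyInd (blockProd S T) = nonemptyInd S * nonemptyInd T := by
  have h : (blockProd S T).Nonempty ↔ S.Nonempty ∧ T.Nonempty := by
    constructor
    · rintro ⟨x, h1, h2⟩
      exact ⟨⟨_, h1⟩, ⟨_, h2⟩⟩
    · rintro ⟨⟨x, hx⟩, ⟨y, hy⟩⟩
      refine ⟨Fin.append x y, ?_, ?_⟩
      · convert hx
        ext i
        simp
      · convert hy
        ext i
        simp
  simp only [nonemptyInd, h]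
  split_ifs <;> simp_all

theorem clauseOp_pow_mul_pow_blockProd (a b : ℕ) (S : Set (Fin N₁ → Bool))
    (T : Set (Fin N₂ → Bool)) :
    (clauseOp K (Fin.castAdd N₂ : Fin N₁ → _) ^ a *
      clauseOp K (Fin.natAdd N₁ : Fin N₂ → _) ^ b) nonemptyInd (blockProd S T) =
      (clauseOp K id ^ a) nonemptyInd S *
        (clauseOp K id ^ b) nonemptyInd T := by
  induction a generalizing S with
  | zero =>
    rw [pow_zero, one_mul, pow_zero, Module.End.one_apply]
    induction b generalizing T with
    | zero => exact nonemptyInd_blockProd S T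
    | succ b ih =>
      rw [pow_succ', pow_succ', Module.End.mul_apply, Module.End.mul_apply, avgOp_apply,
        avgOp_apply, mul_div_assoc', Finset.mul_sum]
      congr 1
      refine Finset.sum_congr rfl fun C _ => ?_
      rw [← ih]
      refine congrArg _ (Set.ext fun x => ?_)
      simp [blockProd, clauseSat, and_assoc]
  | succ a ih =>
    rw [pow_succ', pow_succ', mul_assoc, Module.End.mul_apply (clauseOp K _),
      Module.End.mul_apply (clauseOp K _), avgOp_apply, avgOp_apply, div_mul_eq_mul_div,
      Finset.sum_mul]
    congr 1
    refine Finset.sum_congr rfl fun C _ => ?_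
    rw [← ih]
    refine congrArg _ (Set.ext fun x => ?_)
    simp [blockProd, clauseSat, and_right_comm]

theorem split_clauseOp_le (h₁ : 1 ≤ N₁) (h₂ : 1 ≤ N₂) {q r : ℝ}
    (hq : q = N₁ / (N₁ + N₂)) (hr : r = N₂ / (N₁ + N₂)) :
    (q • clauseOp K (Fin.castAdd N₂ : Fin N₁ → _) +
      r • clauseOp K (Fin.natAdd N₁ : Fin N₂ → _)) nonemptyInd ≤
      clauseOp K (id : Fin (N₁ + N₂) → _) nonemptyInd := fun S => by
  have : Nonempty (Fin N₁) := ⟨⟨0, h₁⟩⟩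
  have : Nonempty (Fin N₂) := ⟨⟨0, h₂⟩⟩
  have : Nonempty (Fin (N₁ + N₂)) := ⟨⟨0, by omega⟩⟩
  have h₁' : (0 : ℝ) < N₁ := by exact_mod_cast h₁
  have h₂' : (0 : ℝ) < N₂ := by exact_mod_cast h₂
  have hqr : q + r = 1 := by rw [hq, hr]; field_simp
  simp only [LinearMap.add_apply, LinearMap.smul_apply, Pi.add_apply, Pi.smul_apply, smul_eq_mul]
  rcases S.eq_empty_or_nonempty with rfl | hS
  · simp [avgOp_nonemptyInd_empty]
  rw [clauseOp_nonemptyInd _ hS, clauseOp_nonemptyInd _ hS, clauseOp_nonemptyInd _ hS]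
  simp only [Fintype.card_fin, id]
  set f₁ := (Finset.univ.filter fun w : Fin N₁ => frozen S (Fin.castAdd N₂ w)).card
  set f₂ := (Finset.univ.filter fun w : Fin N₂ => frozen S (Fin.natAdd N₁ w)).card
  have hf : (Finset.univ.filter fun w : Fin (N₁ + N₂) => frozen S w).card = f₁ + f₂ := by
    simp only [f₁, f₂, Finset.card_filter, Fin.sum_univ_add]
  have hmix : ((f₁ + f₂ : ℕ) : ℝ) / ((N₁ + N₂ : ℕ) : ℝ) = q * (f₁ / N₁) + r * (f₂ / N₂) := by
    rw [hq, hr]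
    push_cast
    field_simp
  have hconv := (convexOn_pow (𝕜 := ℝ) K).2 (x := f₁ / N₁) (y := f₂ / N₂)
    (Set.mem_Ici.2 (by positivity)) (Set.mem_Ici.2 (by positivity))
    (show 0 ≤ q by rw [hq]; positivity) (show 0 ≤ r by rw [hr]; positivity) hqr
  simp only [smul_eq_mul] at hconv
  rw [hf, hmix]
  have hp : (0 : ℝ) < 2⁻¹ ^ K := by positivity
  nlinarith [mul_le_mul_of_nonneg_left hconv hp.le]

theorem split_clauseOp_pow_le (h₁ : 1 ≤ N₁) (h₂ : 1 ≤ N₂) {q r : ℝ}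
    (hq : q = N₁ / (N₁ + N₂)) (hr : r = N₂ / (N₁ + N₂)) (M : ℕ) :
    ((q • clauseOp K (Fin.castAdd N₂ : Fin N₁ → _) +
      r • clauseOp K (Fin.natAdd N₁ : Fin N₂ → _)) ^ M) nonemptyInd ≤
      (clauseOp K (id : Fin (N₁ + N₂) → _) ^ M) nonemptyInd := by
  set A := clauseOp K (id : Fin (N₁ + N₂) → _)
  set B := q • clauseOp K (Fin.castAdd N₂ : Fin N₁ → _) +
      r • clauseOp K (Fin.natAdd N₁ : Fin N₂ → _) with hB
  have hcomm : Commute B A :=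
    ((avgOp_commute _ _).smul_left q).add_left ((avgOp_commute _ _).smul_left r)
  have hmono : Monotone B := fun F G h S => by
    have hq0 : 0 ≤ q := by rw [hq]; positivity
    have hr0 : 0 ≤ r := by rw [hr]; positivity
    simp only [hB, LinearMap.add_apply, LinearMap.smul_apply, Pi.add_apply, Pi.smul_apply,
      smul_eq_mul]
    gcongr
    · exact avgOp_mono _ h S
    · exact avgOp_mono _ h S
  induction M with
  | zero => exact le_rfl
  | succ M ih =>
    calc (B ^ (M + 1)) nonemptyInd = B ((B ^ M) nonemptyInd) := by rw [pow_succ']; rfl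
      _ ≤ B ((A ^ M) nonemptyInd) := hmono ih
      _ = (A ^ M) (B nonemptyInd) := by
        rw [← Module.End.mul_apply, (hcomm.pow_right M).eq, Module.End.mul_apply]
      _ ≤ (A ^ M) (A nonemptyInd) := avgOp_pow_mono _ M (split_clauseOp_le h₁ h₂ hq hr)
      _ = (A ^ (M + 1)) nonemptyInd := by rw [pow_succ]; rfl

theorem smul_pow_mul_smul_pow_mul_natCast_apply {α : Type*} (A B : Module.End ℝ (α → ℝ))
    (q r : ℝ) (a b n : ℕ) (F : α → ℝ) (S : α) :
    ((q • A) ^ a * (r • B) ^ b * (n : Module.End ℝ (α → ℝ))) F S =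
      q ^ a * r ^ b * n * (A ^ a * B ^ b) F S := by
  rw [smul_pow, smul_pow, smul_mul_smul_comm, ← nsmul_eq_mul', LinearMap.smul_apply,
    LinearMap.smul_apply, Pi.smul_apply, Pi.smul_apply, nsmul_eq_mul, smul_eq_mul]
  ring

theorem binomial_mul_pSat_le (h₁ : 1 ≤ N₁) (h₂ : 1 ≤ N₂) {q r : ℝ}
    (hq : q = N₁ / (N₁ + N₂)) (hr : r = N₂ / (N₁ + N₂)) {M b : ℕ} (hb : b ≤ M) :
    q ^ b * r ^ (M - b) * M.choose b * (pSat N₁ K b * pSat N₂ K (M - b)) ≤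
      pSat (N₁ + N₂) K M := by
  have hq0 : 0 ≤ q := by rw [hq]; positivity
  have hr0 : 0 ≤ r := by rw [hr]; positivity
  have h := split_clauseOp_pow_le (K := K) h₁ h₂ hq hr M Set.univ
  rw [← pSat_eq, (((avgOp_commute _ _).smul_left q).smul_right r).add_pow,
    LinearMap.sum_apply, Finset.sum_apply] at h
  simp only [smul_pow_mul_smul_pow_mul_natCast_apply] at h
  refine le_trans ?_ ((Finset.single_le_sum (fun m _ => ?_)
    (Finset.mem_range.2 (Nat.lt_succ_of_le hb))).trans h)
  · rw [pSat_eq, pSat_eq, ← clauseOp_pow_mul_pow_blockProd]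
    simp [blockProd]
  · exact mul_nonneg (by positivity) (avgOp_pow_nonemptyInd_nonneg _ _ _ _ _)

end Split

/-- A most likely value of a binomial variable: it has probability at least `1 / (M + 1)` and
lies between `(M + 1) q - 1` and `(M + 1) q`. -/
theorem exists_binomial_mode (M : ℕ) {q r : ℝ} (hq : 0 < q) (hr : 0 < r) (hqr : q + r = 1) :
    ∃ b ≤ M, 1 / ((M : ℝ) + 1) ≤ q ^ b * r ^ (M - b) * M.choose b ∧
      (b : ℝ) ≤ (M + 1) * q ∧ (M + 1) * q ≤ b + 1 := by
  set t : ℕ → ℝ := fun b => q ^ b * r ^ (M - b) * M.choose b with ht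
  have hsum : ∑ b ∈ Finset.range (M + 1), t b = 1 := by
    rw [← add_pow, hqr, one_pow]
  have hpos : ∀ b ≤ M, 0 < t b := fun b hb => by
    have := Nat.choose_pos hb
    positivity
  have hstep : ∀ b < M, t (b + 1) * ((b + 1) * r) = t b * ((M - b) * q) := fun b hb => by
    have h := congrArg (Nat.cast (R := ℝ)) (Nat.choose_succ_right_eq M b)
    push_cast [Nat.cast_sub hb.le] at h
    have h' : M - b = M - (b + 1) + 1 := by omega
    simp only [ht]
    rw [h', pow_succ, pow_succ]
    linear_combination q ^ b * q * r ^ (M - (b + 1)) * r * h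
  obtain ⟨b, hbM, hmax⟩ := Finset.exists_max_image (Finset.range (M + 1)) t ⟨0, by simp⟩
  have hb : b ≤ M := Nat.lt_succ_iff.1 (Finset.mem_range.1 hbM)
  refine ⟨b, hb, ?_, ?_, ?_⟩
  · rw [div_le_iff₀ (by positivity)]
    have h := Finset.sum_le_card_nsmul _ _ _ hmax
    rw [hsum, Finset.card_range, nsmul_eq_mul] at h
    push_cast at h
    linarith
  · rcases b with _ | b
    · push_cast
      positivity
    · have h := hmax b (Finset.mem_range.2 (by omega))
      have hs := hstep b hb
      have hc : t (b + 1) * ((b + 1) * r) ≤ t (b + 1) * ((M - b) * q) := by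
        rw [hs]
        have : (b : ℝ) ≤ M := by exact_mod_cast (by omega : b ≤ M)
        gcongr
      have hc' := le_of_mul_le_mul_left hc (hpos _ hb)
      push_cast
      rw [eq_sub_of_add_eq' hqr] at hc'
      linarith
  · rcases hb.lt_or_eq with hlt | rfl
    · have h := hmax (b + 1) (Finset.mem_range.2 (by omega))
      have hs := hstep b hlt
      have hc : t b * ((M - b) * q) ≤ t b * ((b + 1) * r) := by
        rw [← hs]
        gcongr
      have hc' := le_of_mul_le_mul_left hc (hpos _ hb)
      rw [eq_sub_of_add_eq' hqr] at hc'
      linarith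
    · nlinarith

theorem pSat_add_ge {c : ℝ} (hc : 0 < c) {K N₁ N₂ : ℕ} (hK : 2 ≤ K) (h₁ : 1 ≤ N₁)
    (h₂ : 1 ≤ N₂) :
    1 / ((⌊c * ((N₁ + N₂ : ℕ) : ℝ)⌋₊ : ℝ) + 1) *
      (((1 - (2⁻¹ : ℝ) ^ K) * pSat N₁ K ⌊c * (N₁ : ℝ)⌋₊) *
        ((1 - (2⁻¹ : ℝ) ^ K) * pSat N₂ K ⌊c * (N₂ : ℝ)⌋₊)) ≤
      pSat (N₁ + N₂) K ⌊c * ((N₁ + N₂ : ℕ) : ℝ)⌋₊ := by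
  have h₁' : (0 : ℝ) < N₁ := by exact_mod_cast h₁
  have h₂' : (0 : ℝ) < N₂ := by exact_mod_cast h₂
  set M := ⌊c * ((N₁ + N₂ : ℕ) : ℝ)⌋₊
  obtain ⟨q, hq⟩ : ∃ q : ℝ, q = N₁ / (N₁ + N₂) := ⟨_, rfl⟩
  obtain ⟨r, hr⟩ : ∃ r : ℝ, r = N₂ / (N₁ + N₂) := ⟨_, rfl⟩
  have hq0 : 0 < q := by rw [hq]; positivity
  have hr0 : 0 < r := by rw [hr]; positivity
  have hqr : q + r = 1 := by rw [hq, hr]; field_simp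
  have hM : (M : ℝ) ≤ c * (N₁ + N₂) := by
    rw [← Nat.cast_add]
    exact Nat.floor_le (by positivity)
  have hMq : M * q ≤ c * N₁ := by
    calc M * q ≤ c * (N₁ + N₂) * q := by gcongr
      _ = c * N₁ := by rw [hq]; field_simp
  have hMr : M * r ≤ c * N₂ := by
    calc M * r ≤ c * (N₁ + N₂) * r := by gcongr
      _ = c * N₂ := by rw [hr]; field_simp
  obtain ⟨b, hb, hmode, hle, hge⟩ := exists_binomial_mode M hq0 hr0 hqr
  have hfloor₁ : b ≤ ⌊c * (N₁ : ℝ)⌋₊ + 1 := by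
    have := Nat.lt_floor_add_one (c * (N₁ : ℝ))
    have : (b : ℝ) < (⌊c * (N₁ : ℝ)⌋₊ + 1 + 1 : ℕ) := by
      push_cast
      linarith
    exact Nat.lt_succ_iff.1 (Nat.cast_lt.1 this)
  have hfloor₂ : M - b ≤ ⌊c * (N₂ : ℝ)⌋₊ + 1 := by
    have := Nat.lt_floor_add_one (c * (N₂ : ℝ))
    have : ((M - b : ℕ) : ℝ) < (⌊c * (N₂ : ℝ)⌋₊ + 1 + 1 : ℕ) := by
      rw [Nat.cast_sub hb]
      push_cast
      rw [eq_sub_of_add_eq' hqr] at hMr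
      linarith
    exact Nat.lt_succ_iff.1 (Nat.cast_lt.1 this)
  have hd := one_sub_two_inv_pow_pos hK
  have hp₁ := pSat_pos h₁ hK ⌊c * (N₁ : ℝ)⌋₊
  have hp₂ := pSat_pos h₂ hK ⌊c * (N₂ : ℝ)⌋₊
  refine le_trans ?_ (binomial_mul_pSat_le (K := K) h₁ h₂ hq hr hb)
  exact mul_le_mul hmode (mul_le_mul (le_pSat_of_le_succ h₁ hfloor₁)
    (le_pSat_of_le_succ h₂ hfloor₂) (by positivity) (pSat_pos h₁ hK _).le)
    (by positivity) (by positivity)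

/-- Near-superadditivity of the log satisfiability probability of random `K`-SAT: there
exist `α ∈ (0,1)` and `C > 0` such that for all `N₁, N₂ ≥ 1` with `N = N₁ + N₂`,
`log p(N, ⌊cN⌋) ≥ log p(N₁, ⌊cN₁⌋) + log p(N₂, ⌊cN₂⌋) − C N^α`. -/
theorem ksat_log_sat_prob_superadditive (c : ℝ) (hc : 0 < c) (K : ℕ) (hK : 2 ≤ K) :
    ∃ α ∈ Set.Ioo (0 : ℝ) 1, ∃ C : ℝ, 0 < C ∧
      ∀ N₁ N₂ : ℕ, 1 ≤ N₁ → 1 ≤ N₂ →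
        Real.log (pSat (N₁ + N₂) K ⌊c * ((N₁ + N₂ : ℕ) : ℝ)⌋₊) ≥
          Real.log (pSat N₁ K ⌊c * (N₁ : ℝ)⌋₊) +
            Real.log (pSat N₂ K ⌊c * (N₂ : ℝ)⌋₊) -
            C * ((N₁ + N₂ : ℕ) : ℝ) ^ α := by
  have hd := one_sub_two_inv_pow_pos hK
  set d := 1 - (2⁻¹ : ℝ) ^ K with hd_def
  have hlogd : Real.log d ≤ 0 := Real.log_nonpos hd.le (sub_le_self _ (by positivity))
  refine ⟨1 / 2, by norm_num, 2 * (c + 1) ^ (1 / 2 : ℝ) - 2 * Real.log d, ?_, ?_⟩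
  · have : 0 < (c + 1) ^ (1 / 2 : ℝ) := by positivity
    linarith
  intro N₁ N₂ h₁ h₂
  have key := pSat_add_ge hc hK h₁ h₂
  have hp₁ := pSat_pos h₁ hK ⌊c * (N₁ : ℝ)⌋₊
  have hp₂ := pSat_pos h₂ hK ⌊c * (N₂ : ℝ)⌋₊
  rw [← hd_def] at key
  have hN : (1 : ℝ) ≤ ((N₁ + N₂ : ℕ) : ℝ) := by exact_mod_cast (by omega : 1 ≤ N₁ + N₂)
  set N : ℝ := ((N₁ + N₂ : ℕ) : ℝ)
  have hlog := Real.log_le_log (by positivity) key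
  rw [Real.log_mul (by positivity) (by positivity), Real.log_mul (by positivity) (by positivity),
    Real.log_mul hd.ne' hp₁.ne', Real.log_mul hd.ne' hp₂.ne', one_div, Real.log_inv] at hlog
  have hM : Real.log ((⌊c * N⌋₊ : ℝ) + 1) ≤ 2 * (c + 1) ^ (1 / 2 : ℝ) * N ^ (1 / 2 : ℝ) := by
    have hle : (⌊c * N⌋₊ : ℝ) + 1 ≤ (c + 1) * N := by
      have := Nat.floor_le (show 0 ≤ c * N by positivity)
      linarith
    calc Real.log ((⌊c * N⌋₊ : ℝ) + 1) ≤ Real.log ((c + 1) * N) :=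
          Real.log_le_log (by positivity) hle
      _ ≤ ((c + 1) * N) ^ (1 / 2 : ℝ) / (1 / 2) :=
          Real.log_le_rpow_div (by positivity) (by norm_num)
      _ = 2 * (c + 1) ^ (1 / 2 : ℝ) * N ^ (1 / 2 : ℝ) := by
          rw [Real.mul_rpow (by positivity) (by positivity)]
          ring
  have hN' : 1 ≤ N ^ (1 / 2 : ℝ) := Real.one_le_rpow hN (by norm_num)
  nlinarith [mul_le_mul_of_nonneg_left hN' (neg_nonneg.2 hlogd)]
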